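/- arXiv:2301.04759 — 2 statements merged into one kernel-verified Lean document; each statement's English description precedes it below -/
import Mathlib

section
/- The Omega functions Ω_0, …, Ω_{d−1} are linearly independent over ℂ: if c_0, …, c_{d−1} ∈ ℂ satisfy Σ_{k=0}^{d−1} c_k Ω_k(s) = 0 for all s with Re s > 0, then c_0 = c_1 = … = c_{d−1} = 0. -/
/-- The polynomial `P₀(t) = -t^d/d + ∑_{k=1}^{d-1} a_k t^k`. -/
noncomputable def P0 (d : ℕ) (a : ℕ → ℂ) (t : ℂ) : ℂ :=
  -t ^ d / (d : ℂ) + ∑ k ∈ Finset.Ico 1 d, a k * t ^ k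

/-- The Omega function `Ω_k(s) = e^{2πiks/d} ∫_0^∞ u^{s-1} e^{P₀(ω_k u)} du`, for `Re s > 0`,
where `ω_k = e^{2πik/d}` and `u^{s-1} = exp((s-1) log u)` for real `u > 0`. -/
noncomputable def OmegaFn (d : ℕ) (a : ℕ → ℂ) (k : ℕ) (s : ℂ) : ℂ :=
  Complex.exp (2 * Real.pi * Complex.I * k * s / d) *
    ∫ u in Set.Ioi (0 : ℝ),
      (u : ℂ) ^ (s - 1) *
        Complex.exp (P0 d a (Complex.exp (2 * Real.pi * Complex.I * k / d) * u))

open Complex MeasureTheory Filter Topology Set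

/-- An integral depending on a parameter `z`, whose integrand is entire in `z` and dominated near
`z₀` by an integrable function, is complex differentiable at `z₀`. -/
theorem differentiableAt_integral_of_dominated {α : Type*} [MeasurableSpace α] {μ : Measure α}
    {F : ℂ → α → ℂ} {bound : α → ℝ} {z₀ : ℂ} {s : Set ℂ} (hs : s ∈ 𝓝 z₀)
    (hmeas : ∀ z, AEStronglyMeasurable (F z) μ)
    (hbound : ∀ᵐ a ∂μ, ∀ z ∈ s, ‖F z a‖ ≤ bound a) (hint : Integrable bound μ)
    (hdiff : ∀ a, Differentiable ℂ (fun z => F z a)) :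
    DifferentiableAt ℂ (fun z => ∫ a, F z a ∂μ) z₀ := by
  obtain ⟨r, hr, hrs⟩ := Metric.mem_nhds_iff.1 hs
  have hr2 : 0 < r / 2 := by positivity
  have hmeas' : AEStronglyMeasurable (fun a => deriv (fun z => F z a) z₀) μ := by
    have htend : Tendsto (fun n : ℕ => ((n : ℂ) + 1)⁻¹) atTop (𝓝[≠] 0) := by
      refine tendsto_nhdsWithin_iff.2 ⟨?_, Eventually.of_forall fun n => ?_⟩
      · simpa using tendsto_one_div_add_atTop_nhds_zero_nat (𝕜 := ℂ)
      · simpa using Nat.cast_add_one_ne_zero (R := ℂ) n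
    refine aestronglyMeasurable_of_tendsto_ae atTop
      (f := fun (n : ℕ) a => (((n : ℂ) + 1)⁻¹)⁻¹ • (F (z₀ + ((n : ℂ) + 1)⁻¹) a - F z₀ a))
      (fun n => ((hmeas (z₀ + ((n : ℂ) + 1)⁻¹)).sub (hmeas z₀)).const_smul (((n : ℂ) + 1)⁻¹)⁻¹) ?_
    filter_upwards with a
    exact (hasDerivAt_iff_tendsto_slope_zero.1 (hdiff a z₀).hasDerivAt).comp htend
  refine (hasDerivAt_integral_of_dominated_loc_of_deriv_le
    (F' := fun z a => deriv (fun z => F z a) z) (bound := fun a => bound a / (r / 2))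
    (Metric.ball_mem_nhds z₀ hr2) (Eventually.of_forall hmeas)
    ?_ hmeas' ?_ (hint.div_const _) ?_).2.differentiableAt
  · refine hint.mono' (hmeas z₀) ?_
    filter_upwards [hbound] with a ha using ha z₀ (hrs (Metric.mem_ball_self hr))
  · filter_upwards [hbound] with a ha z hz
    refine norm_deriv_le_of_forall_mem_sphere_norm_le hr2 (hdiff a).diffContOnCl fun y hy => ?_
    refine ha y (hrs ?_)
    rw [Metric.mem_ball] at hz ⊢
    rw [Metric.mem_sphere] at hy
    linarith [dist_triangle y z z₀]
  · exact Eventually.of_forall fun a z _ => (hdiff a z).hasDerivAt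

/-- Two functions holomorphic on a horizontal strip around the real axis which agree on the real
axis agree on the strip. -/
theorem eqOn_strip_of_eq_real {f g : ℂ → ℂ} {A B : ℝ} (hA : A < 0) (hB : 0 < B)
    (hf : DifferentiableOn ℂ f {z | A < z.im ∧ z.im < B})
    (hg : DifferentiableOn ℂ g {z | A < z.im ∧ z.im < B}) (hfg : ∀ x : ℝ, f x = g x) :
    EqOn f g {z | A < z.im ∧ z.im < B} := by
  have hopen : IsOpen {z : ℂ | A < z.im ∧ z.im < B} :=
    (isOpen_lt continuous_const continuous_im).inter (isOpen_lt continuous_im continuous_const)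
  have hconv : Convex ℝ {z : ℂ | A < z.im ∧ z.im < B} :=
    (convex_halfSpace_im_gt A).inter (convex_halfSpace_im_lt B)
  refine AnalyticOnNhd.eqOn_of_preconnected_of_frequently_eq (z₀ := 0)
    (hf.analyticOnNhd hopen) (hg.analyticOnNhd hopen) hconv.isPreconnected (by simp [hA, hB]) ?_
  have htend : Tendsto (fun x : ℝ => (x : ℂ)) (𝓝[≠] 0) (𝓝[≠] 0) := by
    refine tendsto_nhdsWithin_iff.2 ⟨?_, ?_⟩
    · exact (continuous_ofReal.tendsto' 0 0 (by simp)).mono_left nhdsWithin_le_nhds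
    · filter_upwards [self_mem_nhdsWithin] with x hx using by simpa using hx
  exact htend.frequently (Frequently.of_forall hfg)

/-- A lower power is dominated by an arbitrarily small multiple of a higher power. -/
theorem exists_mul_pow_le {k d : ℕ} (hkd : k < d) {A δ : ℝ} (hA : 0 ≤ A) (hδ : 0 < δ) :
    ∃ C : ℝ, ∀ u : ℝ, 0 ≤ u → A * u ^ k ≤ δ * u ^ d + C := by
  set M := max 1 (A / δ)
  refine ⟨A * M ^ k, fun u hu => ?_⟩
  rcases le_total u M with h | h
  · have : A * u ^ k ≤ A * M ^ k := by gcongr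
    have : 0 ≤ δ * u ^ d := by positivity
    linarith
  · have h1 : 1 ≤ u := (le_max_left _ _).trans h
    have h2 : A ≤ δ * u := by
      have := (le_max_right _ _).trans h
      rwa [div_le_iff₀' hδ] at this
    have h3 : u * u ^ k ≤ u ^ d := by
      rw [← pow_succ']
      exact pow_le_pow_right₀ h1 hkd
    have hM : 0 ≤ A * M ^ k := by positivity
    calc A * u ^ k ≤ δ * u * u ^ k := by gcongr
      _ = δ * (u * u ^ k) := by ring
      _ ≤ δ * u ^ d := by gcongr
      _ ≤ _ := by linarith

/-- On rays, uniformly for bounded directions, the lower-order part of `P0` is dominated by any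
positive multiple of `u ^ d`. -/
theorem exists_norm_sum_le (d : ℕ) (a : ℕ → ℂ) {δ R : ℝ} (hδ : 0 < δ) (hR : 0 ≤ R) :
    ∃ C : ℝ, ∀ ζ : ℂ, ‖ζ‖ ≤ R → ∀ u : ℝ, 0 ≤ u →
      ‖∑ k ∈ Finset.Ico 1 d, a k * (ζ * u) ^ k‖ ≤ δ * u ^ d + C := by
  have key : ∀ k, ∃ C : ℝ, k < d → ∀ u : ℝ, 0 ≤ u →
      ‖a k‖ * R ^ k * u ^ k ≤ δ / d * u ^ d + C := by
    intro k
    by_cases hk : k < d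
    · have hd : (0 : ℝ) < d := by exact_mod_cast (Nat.zero_le k).trans_lt hk
      obtain ⟨C, hC⟩ := exists_mul_pow_le hk (A := ‖a k‖ * R ^ k) (by positivity) (div_pos hδ hd)
      exact ⟨C, fun _ => hC⟩
    · exact ⟨0, fun h => absurd h hk⟩
  choose C hC using key
  refine ⟨∑ k ∈ Finset.Ico 1 d, C k, fun ζ hζ u hu => ?_⟩
  have h1 : ‖∑ k ∈ Finset.Ico 1 d, a k * (ζ * u) ^ k‖
      ≤ ∑ k ∈ Finset.Ico 1 d, (δ / d * u ^ d + C k) := by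
    refine norm_sum_le_of_le _ fun k hk => ?_
    refine le_trans ?_ (hC k (Finset.mem_Ico.1 hk).2 u hu)
    rw [norm_mul, norm_pow, norm_mul, norm_real, Real.norm_of_nonneg hu, mul_pow, ← mul_assoc]
    gcongr
  refine h1.trans ?_
  rw [Finset.sum_add_distrib, Finset.sum_const, Nat.card_Ico, nsmul_eq_mul]
  refine add_le_add_left ?_ _
  rcases Nat.eq_zero_or_pos d with rfl | hd
  · simpa using hδ.le
  · have hd' : (0 : ℝ) < d := by exact_mod_cast hd
    have : ((d - 1 : ℕ) : ℝ) ≤ d := by exact_mod_cast Nat.sub_le d 1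
    calc ((d - 1 : ℕ) : ℝ) * (δ / d * u ^ d) ≤ d * (δ / d * u ^ d) := by gcongr
      _ = δ * u ^ d := by field_simp

theorem le_one_add_pow {d : ℕ} (hd : 1 ≤ d) {u : ℝ} (hu : 0 ≤ u) : u ≤ 1 + u ^ d := by
  rcases le_total u 1 with h | h
  · linarith [pow_nonneg hu d]
  · linarith [le_self_pow₀ h (by omega : d ≠ 0)]

theorem P0_re_mul (d : ℕ) (a : ℕ → ℂ) (ζ : ℂ) (u : ℝ) :
    (P0 d a (ζ * u)).re = -((ζ ^ d).re * u ^ d / d) +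
      (∑ k ∈ Finset.Ico 1 d, a k * (ζ * u) ^ k).re := by
  have : -(ζ * (u : ℂ)) ^ d / (d : ℂ) = -(ζ ^ d) * ((u ^ d / d : ℝ) : ℂ) := by
    push_cast; ring
  rw [P0, add_re, this, re_mul_ofReal, neg_re]
  ring

/-- Uniform exponential decay of `exp ∘ P0` along directions with `Re ζ ^ d` bounded below. -/
theorem exists_norm_exp_P0_le {d : ℕ} (hd : 1 ≤ d) (a : ℕ → ℂ) {ε R : ℝ} (hε : 0 < ε)
    (hR : 0 ≤ R) :
    ∃ C b : ℝ, 0 < b ∧ ∀ ζ : ℂ, ‖ζ‖ ≤ R → ε ≤ (ζ ^ d).re → ∀ u : ℝ, 0 ≤ u →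
      ‖exp (P0 d a (ζ * u))‖ ≤ C * Real.exp (-b * u) := by
  have hd' : (0 : ℝ) < d := by exact_mod_cast hd
  have hδ : 0 < ε / (2 * d) := by positivity
  obtain ⟨C, hC⟩ := exists_norm_sum_le d a hδ hR
  refine ⟨Real.exp (C + ε / (2 * d)), ε / (2 * d), hδ, fun ζ hζ hre u hu => ?_⟩
  rw [norm_exp, ← Real.exp_add, Real.exp_le_exp, P0_re_mul]
  have h1 := (re_le_norm _).trans (hC ζ hζ u hu)
  have h2 : ε / d * u ^ d ≤ (ζ ^ d).re * u ^ d / d := by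
    rw [div_mul_eq_mul_div]; gcongr
  have h3 : ε / d * u ^ d = 2 * (ε / (2 * d) * u ^ d) := by field_simp
  have h4 := mul_le_mul_of_nonneg_left (le_one_add_pow hd hu) hδ.le
  linarith

/-- Along a direction with `ζ ^ d = -1` the function `Re P0` tends to infinity. -/
theorem tendsto_P0_re_atTop {d : ℕ} (hd : 1 ≤ d) (a : ℕ → ℂ) {ζ : ℂ} (hζ : ζ ^ d = -1) :
    Tendsto (fun u : ℝ => (P0 d a (ζ * u)).re) atTop atTop := by
  have hd' : (0 : ℝ) < d := by exact_mod_cast hd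
  have hδ : 0 < 1 / (2 * (d : ℝ)) := by positivity
  obtain ⟨C, hC⟩ := exists_norm_sum_le d a hδ (norm_nonneg ζ)
  have hlin : Tendsto (fun u : ℝ => 1 / (2 * (d : ℝ)) * u + (-1 / (2 * (d : ℝ)) - C)) atTop atTop :=
    tendsto_atTop_add_const_right _ _ (tendsto_id.const_mul_atTop hδ)
  refine tendsto_atTop_mono' _ ?_ hlin
  filter_upwards [eventually_ge_atTop 0] with u hu
  rw [P0_re_mul, hζ]
  have h1 := (abs_le.1 ((abs_re_le_norm _).trans (hC ζ le_rfl u hu))).1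
  have h4 := mul_le_mul_of_nonneg_left (le_one_add_pow hd hu) hδ.le
  have h5 : -((-1 : ℂ).re * u ^ d / d) = 2 * (1 / (2 * (d : ℝ)) * u ^ d) := by
    simp; field_simp
  have h6 : -1 / (2 * (d : ℝ)) = -(1 / (2 * (d : ℝ))) := by ring
  rw [h5, h6]
  linarith

theorem differentiable_P0 (d : ℕ) (a : ℕ → ℂ) : Differentiable ℂ (P0 d a) := by
  unfold P0; fun_prop

theorem norm_ofReal_cpow_sub_one {s : ℂ} (hs : s.re = 1) {u : ℝ} (hu : 0 < u) :
    ‖(u : ℂ) ^ (s - 1)‖ = 1 := by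
  rw [norm_cpow_eq_rpow_re_of_pos hu]
  simp [hs]

theorem aestronglyMeasurable_cpow_mul {f : ℂ → ℂ} (hf : Continuous f) (s : ℂ) :
    AEStronglyMeasurable (fun u : ℝ => (u : ℂ) ^ (s - 1) * f u) (volume.restrict (Ioi 0)) := by
  refine ContinuousOn.aestronglyMeasurable (fun u hu => ?_) measurableSet_Ioi
  exact ((continuousAt_ofReal_cpow_const _ _ (Or.inr (ne_of_gt hu))).mul
    (hf.comp continuous_ofReal).continuousAt).continuousWithinAt

theorem integrableOn_exp_P0 {d : ℕ} (hd : 1 ≤ d) (a : ℕ → ℂ) {ζ : ℂ} (hζ : 0 < (ζ ^ d).re) {s : ℂ}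
    (hs : s.re = 1) :
    IntegrableOn (fun u : ℝ => (u : ℂ) ^ (s - 1) * exp (P0 d a (ζ * u))) (Ioi 0) := by
  obtain ⟨C, b, hb, hC⟩ := exists_norm_exp_P0_le hd a hζ (norm_nonneg ζ)
  refine Integrable.mono' ((integrableOn_exp_mul_Ioi (neg_lt_zero.2 hb) 0).const_mul C)
    (aestronglyMeasurable_cpow_mul (f := fun z => exp (P0 d a (ζ * z)))
      ((differentiable_P0 d a).continuous.comp (by fun_prop)).cexp s) ?_
  filter_upwards [ae_restrict_mem measurableSet_Ioi] with u hu
  rw [norm_mul, norm_ofReal_cpow_sub_one hs hu, one_mul]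
  exact hC ζ le_rfl le_rfl u (le_of_lt hu)

theorem ofReal_exp_cpow (x : ℝ) (s : ℂ) : ((Real.exp x : ℝ) : ℂ) ^ s = exp (x * s) := by
  rw [cpow_def_of_ne_zero (by exact_mod_cast (Real.exp_pos x).ne'), ← ofReal_log (Real.exp_pos x).le,
    Real.log_exp]

theorem re_exp_pow_pos {d : ℕ} (hd : 1 ≤ d) {w : ℂ} (hw : |w.im| < Real.pi / (2 * d)) :
    0 < (exp w ^ d).re := by
  have hd' : (0 : ℝ) < d := by exact_mod_cast hd
  rw [← exp_nat_mul, exp_re]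
  refine mul_pos (Real.exp_pos _) (Real.cos_pos_of_mem_Ioo ?_)
  have h1 : ((d : ℂ) * w).im = d * w.im := by simp
  have h2 : d * (Real.pi / (2 * d)) = Real.pi / 2 := by field_simp
  rw [h1, mem_Ioo, ← abs_lt, abs_mul, abs_of_pos hd', ← h2]
  gcongr

/-- Rotation of the contour of the Mellin transform of `exp ∘ P0` inside the sector of decay. -/
theorem integral_rotate {d : ℕ} (hd : 1 ≤ d) (a : ℕ → ℂ) {ω : ℂ} (hω : ω ^ d = 1) {s : ℂ}
    (hs : s.re = 1) {w : ℂ} (hw : |w.im| < Real.pi / (2 * d)) :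
    ∫ u in Ioi (0 : ℝ), (u : ℂ) ^ (s - 1) * exp (P0 d a (ω * exp w * u)) =
      exp (-w * s) * ∫ u in Ioi (0 : ℝ), (u : ℂ) ^ (s - 1) * exp (P0 d a (ω * u)) := by
  have hd' : (0 : ℝ) < d := by exact_mod_cast hd
  have hpos : 0 < Real.pi / (2 * d) := by have := Real.pi_pos; positivity
  refine eqOn_strip_of_eq_real (neg_lt_zero.2 hpos) hpos
    (f := fun w => ∫ u in Ioi (0 : ℝ), (u : ℂ) ^ (s - 1) * exp (P0 d a (ω * exp w * u)))
    (g := fun w => exp (-w * s) * ∫ u in Ioi (0 : ℝ), (u : ℂ) ^ (s - 1) * exp (P0 d a (ω * u)))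
    (fun w hw => DifferentiableAt.differentiableWithinAt ?_)
    (by fun_prop) (fun x => ?_) (abs_lt.1 hw)
  · have hre := re_exp_pow_pos hd (abs_lt.2 hw)
    have hε : 0 < (exp w ^ d).re / 2 := by positivity
    have hR : 0 ≤ ‖ω * exp w‖ + 1 := by positivity
    obtain ⟨C, b, hb, hC⟩ := exists_norm_exp_P0_le hd a hε hR
    have hev1 : ∀ᶠ z in 𝓝 w, ‖ω * exp z‖ < ‖ω * exp w‖ + 1 :=
      (by fun_prop : Continuous fun z => ‖ω * exp z‖).continuousAt.eventually_lt_const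
        (by linarith)
    have hev2 : ∀ᶠ z in 𝓝 w, (exp w ^ d).re / 2 < (exp z ^ d).re :=
      (by fun_prop : Continuous fun z => (exp z ^ d).re).continuousAt.eventually_const_lt
        (by linarith)
    refine differentiableAt_integral_of_dominated (bound := fun u => C * Real.exp (-b * u))
      (hev1.and hev2) (fun z => ?_) ?_
      ((integrableOn_exp_mul_Ioi (neg_lt_zero.2 hb) 0).const_mul C) (fun u => ?_)
    · exact aestronglyMeasurable_cpow_mul (f := fun v => exp (P0 d a (ω * exp z * v)))
        ((differentiable_P0 d a).continuous.comp (by fun_prop)).cexp s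
    · filter_upwards [ae_restrict_mem measurableSet_Ioi] with u hu z hz
      rw [norm_mul, norm_ofReal_cpow_sub_one hs hu, one_mul]
      refine hC _ hz.1.le ?_ u (le_of_lt hu)
      rw [mul_pow, hω, one_mul]
      exact hz.2.le
    · exact ((differentiable_P0 d a).comp (by fun_prop)).cexp.const_mul _
  · have := mellin_comp_mul_left (fun u : ℝ => exp (P0 d a (ω * u))) s (Real.exp_pos x)
    rw [ofReal_exp_cpow] at this
    simp only [mellin, smul_eq_mul] at this
    simp only [ofReal_mul, ofReal_exp, ← mul_assoc] at this
    simpa using this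

/-- Exponential decay on the line `Re s = 1` of the Mellin transform of `exp ∘ P0`. -/
theorem exists_norm_integral_le {d : ℕ} (hd : 1 ≤ d) (a : ℕ → ℂ) {ω : ℂ} (hω : ω ^ d = 1) :
    ∃ K θ : ℝ, 0 < θ ∧ ∀ τ : ℝ,
      ‖∫ u in Ioi (0 : ℝ), (u : ℂ) ^ ((1 + τ * I : ℂ) - 1) * exp (P0 d a (ω * u))‖
        ≤ K * Real.exp (-θ * |τ|) := by
  have hd' : (0 : ℝ) < d := by exact_mod_cast hd
  have hpi := Real.pi_pos
  set θ := Real.pi / (4 * d)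
  have hθ : 0 < θ := by positivity
  have hθ' : θ < Real.pi / (2 * d) := by
    simp only [θ]; gcongr; norm_num
  let B : ℝ → ℝ := fun y => ∫ u in Ioi (0 : ℝ), ‖exp (P0 d a (ω * exp (y * I) * u))‖
  have key : ∀ y : ℝ, |y| = θ → ∀ τ : ℝ,
      Real.exp (y * τ) *
        ‖∫ u in Ioi (0 : ℝ), (u : ℂ) ^ ((1 + τ * I : ℂ) - 1) * exp (P0 d a (ω * u))‖ ≤ B y := by
    intro y hy τ
    have hs : (1 + τ * I : ℂ).re = 1 := by simp
    have h1 := integral_rotate hd a hω hs (w := y * I) (by simpa [hy] using hθ')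
    have h2 : ‖exp (-(y * I) * (1 + τ * I))‖ = Real.exp (y * τ) := by
      rw [norm_exp]; simp
    rw [← h2, ← norm_mul, ← h1]
    refine (norm_integral_le_integral_norm _).trans (le_of_eq ?_)
    refine setIntegral_congr_fun measurableSet_Ioi fun u hu => ?_
    simp only [norm_mul, norm_ofReal_cpow_sub_one hs hu, one_mul]
  refine ⟨max (B θ) (B (-θ)), θ, hθ, fun τ => ?_⟩
  rw [neg_mul, Real.exp_neg, ← div_eq_mul_inv, le_div_iff₀ (Real.exp_pos _), mul_comm]
  rcases le_total 0 τ with h | h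
  · rw [abs_of_nonneg h]
    exact (key θ (abs_of_pos hθ) τ).trans (le_max_left _ _)
  · rw [abs_of_nonpos h, mul_neg, ← neg_mul]
    exact (key (-θ) (by rw [abs_neg, abs_of_pos hθ]) τ).trans (le_max_right _ _)

theorem integrable_exp_neg_mul_abs {δ : ℝ} (hδ : 0 < δ) :
    Integrable fun τ : ℝ => Real.exp (-δ * |τ|) := by
  rw [← integrableOn_univ, ← Iic_union_Ioi (a := (0 : ℝ))]
  refine IntegrableOn.union ?_ ?_
  · refine (integrableOn_exp_mul_Iic hδ 0).congr_fun (fun τ hτ => ?_) measurableSet_Iic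
    rw [abs_of_nonpos hτ, neg_mul_neg]
  · refine (integrableOn_exp_mul_Ioi (neg_lt_zero.2 hδ) 0).congr_fun (fun τ hτ => ?_)
      measurableSet_Ioi
    rw [abs_of_pos hτ]

/-- If the Mellin transform of an entire function decays like `exp (-θ τ)` at the upper end and
like `exp (-β |τ|)` at the lower end of the line `Re s = 1`, then the function is
`O(1 / |z|)` along every ray `arg z = -α` with `0 < α < β`. -/
theorem exists_norm_le_of_mellin_decay {f : ℂ → ℂ} (hf : Differentiable ℂ f)
    (hconv : MellinConvergent (fun u : ℝ => f u) 1) {K α β θ : ℝ} (hθ : 0 < θ) (hα : 0 < α)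
    (hαβ : α < β)
    (hpos : ∀ τ : ℝ, 0 ≤ τ →
      ‖mellin (fun u : ℝ => f u) (1 + τ * I)‖ ≤ K * Real.exp (-θ * τ))
    (hneg : ∀ τ : ℝ, τ ≤ 0 → ‖mellin (fun u : ℝ => f u) (1 + τ * I)‖ ≤ K * Real.exp (β * τ)) :
    ∃ B : ℝ, ∀ x : ℝ, ‖f (exp (x - α * I))‖ ≤ B * Real.exp (-x) := by
  set m : ℝ → ℂ := fun τ => mellin (fun u : ℝ => f u) (1 + τ * I) with hm
  have hK : 0 ≤ K := by simpa using (norm_nonneg _).trans (hpos 0 le_rfl)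
  have hcont : Continuous m := by
    refine continuous_of_dominated (bound := fun u : ℝ => ‖(u : ℂ) ^ ((1 : ℂ) - 1) • f u‖)
      (fun τ => aestronglyMeasurable_cpow_mul hf.continuous _) (fun τ => ?_) hconv.norm ?_
    · filter_upwards [ae_restrict_mem measurableSet_Ioi] with u hu
      rw [norm_smul, norm_smul, norm_ofReal_cpow_sub_one (by simp) hu,
        norm_ofReal_cpow_sub_one (by simp) hu]
    · filter_upwards [ae_restrict_mem measurableSet_Ioi] with u hu
      have hu0 : (u : ℂ) ≠ 0 := by exact_mod_cast (ne_of_gt hu)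
      have : Continuous fun τ : ℝ => (u : ℂ) ^ ((1 + τ * I : ℂ) - 1) :=
        Continuous.const_cpow (by fun_prop) (Or.inl hu0)
      exact this.smul continuous_const
  have hbound : ∀ {δ : ℝ} {z : ℂ}, -β + δ ≤ z.im → z.im ≤ θ - δ → ∀ τ : ℝ,
      ‖exp (-(1 + τ * I) * z) * m τ‖ ≤ K * Real.exp (-z.re) * Real.exp (-δ * |τ|) := by
    intro δ z h1 h2 τ
    have hn : ‖exp (-(1 + τ * I) * z)‖ = Real.exp (-z.re + τ * z.im) := by
      rw [norm_exp]; congr 1; simp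
    rw [norm_mul, hn]
    rcases le_total 0 τ with h | h
    · refine (mul_le_mul_of_nonneg_left (hpos τ h) (Real.exp_pos _).le).trans ?_
      rw [mul_left_comm, ← Real.exp_add, mul_assoc, ← Real.exp_add, abs_of_nonneg h]
      refine mul_le_mul_of_nonneg_left (Real.exp_le_exp.2 ?_) hK
      nlinarith
    · refine (mul_le_mul_of_nonneg_left (hneg τ h) (Real.exp_pos _).le).trans ?_
      rw [mul_left_comm, ← Real.exp_add, mul_assoc, ← Real.exp_add, abs_of_nonpos h]
      refine mul_le_mul_of_nonneg_left (Real.exp_le_exp.2 ?_) hK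
      nlinarith
  have hmeas : ∀ z : ℂ, AEStronglyMeasurable (fun τ : ℝ => exp (-(1 + τ * I) * z) * m τ) :=
    fun z => Continuous.aestronglyMeasurable (by fun_prop)
  let g : ℂ → ℂ := fun z => (1 / (2 * Real.pi) : ℝ) • ∫ τ : ℝ, exp (-(1 + τ * I) * z) * m τ
  have hg : DifferentiableOn ℂ g {z | -β < z.im ∧ z.im < θ} := by
    intro z hz
    refine DifferentiableAt.differentiableWithinAt (DifferentiableAt.fun_const_smul ?_ _)
    set δ := min (z.im + β) (θ - z.im) / 2
    have hmin : 0 < min (z.im + β) (θ - z.im) := lt_min (by linarith [hz.1]) (by linarith [hz.2])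
    have hδ : 0 < δ := by positivity
    have hδ1 : -β + δ < z.im := by
      have := min_le_left (z.im + β) (θ - z.im)
      simp only [δ] at *; linarith
    have hδ2 : z.im < θ - δ := by
      have := min_le_right (z.im + β) (θ - z.im)
      simp only [δ] at *; linarith
    have hnhds : ∀ᶠ y in 𝓝 z, (-β + δ < y.im ∧ y.im < θ - δ) ∧ z.re - 1 < y.re :=
      ((continuous_im.continuousAt.eventually_const_lt hδ1).and
        (continuous_im.continuousAt.eventually_lt_const hδ2)).and
        (continuous_re.continuousAt.eventually_const_lt (by linarith))
    refine differentiableAt_integral_of_dominated hnhds hmeas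
      (bound := fun τ => K * Real.exp (-(z.re - 1)) * Real.exp (-δ * |τ|)) ?_
      ((integrable_exp_neg_mul_abs hδ).const_mul _) (fun τ => by fun_prop)
    refine Eventually.of_forall fun τ y hy => (hbound hy.1.1.le hy.1.2.le τ).trans ?_
    gcongr
    exact hy.2.le
  have hreal : ∀ x : ℝ, f (exp x) = g x := by
    intro x
    set δ := min β θ
    have hδ : 0 < δ := lt_min (hα.trans hαβ) hθ
    have hvert : VerticalIntegrable (mellin fun u : ℝ => f u) 1 := by
      refine Integrable.mono' ((integrable_exp_neg_mul_abs hδ).const_mul K)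
        (by simpa using hcont.aestronglyMeasurable) (Eventually.of_forall fun τ => ?_)
      have := hbound (δ := δ) (z := 0) (by simp [δ]) (by simp [δ]) τ
      simpa using this
    have := mellinInv_mellin_eq 1 (fun u : ℝ => f u) (Real.exp_pos x) (by simpa using hconv) hvert
      (hf.continuous.comp continuous_ofReal).continuousAt
    rw [← ofReal_exp, ← this, mellinInv]
    simp only [g, hm, ofReal_exp_cpow, ofReal_one, smul_eq_mul]
    congr 1
    refine integral_congr_ae (Eventually.of_forall fun τ => ?_)
    simp only [mul_comm]
  have heq := eqOn_strip_of_eq_real (f := fun z => f (exp z)) (g := g)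
    (neg_lt_zero.2 (hα.trans hαβ)) hθ (hf.comp differentiable_exp).differentiableOn hg hreal
  set δ := min (β - α) θ
  have hδ : 0 < δ := lt_min (sub_pos.2 hαβ) hθ
  refine ⟨1 / (2 * Real.pi) * (K * ∫ τ : ℝ, Real.exp (-δ * |τ|)), fun x => ?_⟩
  have him : ((x : ℂ) - α * I).im = -α := by simp
  have hre : ((x : ℂ) - α * I).re = x := by simp
  have h1 : f (exp (x - α * I)) = g (x - α * I) :=
    heq ⟨by rw [him]; linarith, by rw [him]; linarith⟩
  have h2 := norm_integral_le_of_norm_le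
    ((integrable_exp_neg_mul_abs hδ).const_mul (K * Real.exp (-x)))
    (Eventually.of_forall (hre ▸ hbound (δ := δ) (z := x - α * I)
      (by rw [him]; linarith [min_le_left (β - α) θ])
      (by rw [him]; linarith [min_le_right (β - α) θ])))
  rw [integral_const_mul] at h2
  have hpi := Real.pi_pos
  rw [h1, norm_smul, Real.norm_of_nonneg (by positivity)]
  calc _ ≤ 1 / (2 * Real.pi) * (K * Real.exp (-x) * ∫ τ : ℝ, Real.exp (-δ * |τ|)) := by gcongr
    _ = _ := by ring

theorem exp_two_pi_mul_div_pow {d : ℕ} (hd : 1 ≤ d) (k : ℕ) :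
    exp (2 * Real.pi * I * k / d) ^ d = 1 := by
  have hd' : (d : ℂ) ≠ 0 := by exact_mod_cast (by omega : d ≠ 0)
  rw [← exp_nat_mul, mul_div_cancel₀ _ hd', mul_comm]
  exact exp_nat_mul_two_pi_mul_I k

theorem norm_OmegaFn (d : ℕ) (a : ℕ → ℂ) (k : ℕ) (τ : ℝ) :
    ‖OmegaFn d a k (1 + τ * I)‖ = Real.exp (-(2 * Real.pi / d * k * τ)) *
      ‖∫ u in Ioi (0 : ℝ), (u : ℂ) ^ ((1 + τ * I : ℂ) - 1) *
        exp (P0 d a (exp (2 * Real.pi * I * k / d) * u))‖ := by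
  rw [OmegaFn, norm_mul, norm_exp]
  congr 2
  have : 2 * Real.pi * I * k * (1 + τ * I) / d =
      ((-(2 * Real.pi / d * k * τ) : ℝ) : ℂ) + ((2 * Real.pi * k / d : ℝ) : ℂ) * I := by
    push_cast
    linear_combination (2 * Real.pi * k * τ / d : ℂ) * I_sq
  rw [this]
  simp only [add_re, ofReal_re, re_ofReal_mul, I_re, mul_zero, add_zero]

/-- The Omega functions `Ω_0, …, Ω_{d-1}` are linearly independent over `ℂ`:
if `∑_{k=0}^{d-1} c_k Ω_k(s) = 0` for all `Re s > 0`, then all `c_k = 0`. -/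
theorem stmt14 (d : ℕ) (hd : 1 ≤ d) (a : ℕ → ℂ) (c : ℕ → ℂ)
    (h : ∀ s : ℂ, 0 < s.re → ∑ k ∈ Finset.range d, c k * OmegaFn d a k s = 0) :
    ∀ k, k ≤ d - 1 → c k = 0 := by
  by_contra hne
  push Not at hne
  obtain ⟨k₀, hk₀, hck₀⟩ := hne
  have hd' : (0 : ℝ) < d := by exact_mod_cast hd
  have hpi := Real.pi_pos
  obtain ⟨k, hkmem, hkmax⟩ := Finset.exists_max_image ((Finset.range d).filter (c · ≠ 0)) id
    ⟨k₀, Finset.mem_filter.2 ⟨Finset.mem_range.2 (by omega), hck₀⟩⟩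
  obtain ⟨hkd, hck⟩ := Finset.mem_filter.1 hkmem
  rw [Finset.mem_range] at hkd
  have hsum : ∀ s : ℂ, 0 < s.re →
      c k * OmegaFn d a k s = -∑ j ∈ Finset.range k, c j * OmegaFn d a j s := by
    intro s hs
    have h1 : ∑ j ∈ Finset.range (k + 1), c j * OmegaFn d a j s = 0 := by
      rw [← h s hs]
      refine Finset.sum_subset (Finset.range_subset_range.2 hkd) fun j hj hjk => ?_
      have : c j = 0 := by
        by_contra hcj
        have := hkmax j (Finset.mem_filter.2 ⟨hj, hcj⟩)
        simp only [id, Finset.mem_range] at this hjk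
        omega
      rw [this, zero_mul]
    rw [Finset.sum_range_succ] at h1
    linear_combination h1
  choose K θ hθ hK using fun j : ℕ => exists_norm_integral_le hd a (exp_two_pi_mul_div_pow hd j)
  have hK0 : ∀ j, 0 ≤ K j := fun j => by simpa using (norm_nonneg _).trans (hK j 0)
  set ω := exp (2 * Real.pi * I * k / d) with hω
  have hωd : ω ^ d = 1 := exp_two_pi_mul_div_pow hd k
  set L := (∑ j ∈ Finset.range k, ‖c j‖ * K j) / ‖c k‖ with hL
  have hcpos : 0 < ‖c k‖ := norm_pos_iff.2 hck
  have hlow : ∀ τ : ℝ, τ ≤ 0 →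
      ‖∫ u in Ioi (0 : ℝ), (u : ℂ) ^ ((1 + τ * I : ℂ) - 1) * exp (P0 d a (ω * u))‖
        ≤ L * Real.exp (2 * Real.pi / d * τ) := by
    intro τ hτ
    have h1 : ‖c k‖ * ‖OmegaFn d a k (1 + τ * I)‖ ≤
        ∑ j ∈ Finset.range k, ‖c j‖ * K j * Real.exp (-(2 * Real.pi / d * (k - 1) * τ)) := by
      rw [← norm_mul, hsum _ (by simp), norm_neg]
      refine norm_sum_le_of_le _ fun j hj => ?_
      have hjk : (j : ℝ) ≤ k - 1 := by
        have : j + 1 ≤ k := Finset.mem_range.1 hj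
        have : (j : ℝ) + 1 ≤ k := by exact_mod_cast this
        linarith
      have h2 : ‖∫ u in Ioi (0 : ℝ), (u : ℂ) ^ ((1 + τ * I : ℂ) - 1) *
          exp (P0 d a (exp (2 * Real.pi * I * j / d) * u))‖ ≤ K j := by
        refine (hK j τ).trans (mul_le_of_le_one_right (hK0 j) (Real.exp_le_one_iff.2 ?_))
        rw [neg_mul]
        exact neg_nonpos.2 (mul_nonneg (hθ j).le (abs_nonneg τ))
      rw [norm_mul, norm_OmegaFn, mul_assoc ‖c j‖, mul_comm (K j)]
      gcongr ‖c j‖ * (Real.exp ?_ * ?_)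
      have : 2 * Real.pi / d * j ≤ 2 * Real.pi / d * (k - 1) := by gcongr
      nlinarith
    rw [← Finset.sum_mul, norm_OmegaFn] at h1
    rw [hL, div_mul_eq_mul_div, le_div_iff₀ hcpos]
    have h3 := mul_le_mul_of_nonneg_right h1 (Real.exp_pos (2 * Real.pi / d * k * τ)).le
    have h4 : Real.exp (-(2 * Real.pi / d * (k - 1) * τ)) * Real.exp (2 * Real.pi / d * k * τ) =
        Real.exp (2 * Real.pi / d * τ) := by rw [← Real.exp_add]; ring_nf
    have h5 : Real.exp (-(2 * Real.pi / d * k * τ)) * Real.exp (2 * Real.pi / d * k * τ) = 1 := by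
      rw [← Real.exp_add]; simp
    rw [mul_assoc (∑ j ∈ Finset.range k, ‖c j‖ * K j), h4] at h3
    refine le_trans (le_of_eq ?_) h3
    linear_combination (-‖c k‖ * ‖∫ u in Ioi (0 : ℝ), (u : ℂ) ^ ((1 + τ * I : ℂ) - 1) *
      exp (P0 d a (ω * u))‖) * h5
  obtain ⟨B, hB⟩ := exists_norm_le_of_mellin_decay (f := fun z => exp (P0 d a (ω * z)))
    (K := max (K k) L) (α := Real.pi / d) (β := 2 * Real.pi / d)
    ((differentiable_P0 d a).comp (by fun_prop)).cexp
    (integrableOn_exp_P0 hd a (by simp [hωd]) (by simp)) (hθ k) (by positivity)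
    (by gcongr; linarith)
    (fun τ hτ => by
      refine (hK k τ).trans ?_
      rw [abs_of_nonneg hτ]
      gcongr
      exact le_max_left _ _)
    (fun τ hτ => by
      refine (hlow τ hτ).trans ?_
      gcongr
      exact le_max_right _ _)
  have hζ : (ω * exp (-((Real.pi / d : ℝ) * I))) ^ d = -1 := by
    have hdC : (d : ℂ) ≠ 0 := by exact_mod_cast hd'.ne'
    have : (d : ℂ) * -((Real.pi / d : ℝ) * I) = -(Real.pi * I) := by
      push_cast; field_simp
    rw [mul_pow, hωd, one_mul, ← exp_nat_mul, this, exp_neg, exp_pi_mul_I]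
    norm_num
  have hgrow := Real.tendsto_exp_atTop.comp
    ((tendsto_P0_re_atTop hd a hζ).comp Real.tendsto_exp_atTop)
  obtain ⟨x, hx0, hx⟩ := ((eventually_ge_atTop 0).and (hgrow.eventually_gt_atTop |B|)).exists
  have h1 := hB x
  rw [norm_exp, sub_eq_neg_add, exp_add, ← mul_assoc, ← ofReal_exp] at h1
  have h2 : B * Real.exp (-x) ≤ |B| := by
    refine (mul_le_mul_of_nonneg_right (le_abs_self B) (Real.exp_pos _).le).trans ?_
    exact mul_le_of_le_one_right (abs_nonneg B) (Real.exp_le_one_iff.2 (by linarith))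
  exact absurd (h1.trans h2) (not_le.2 hx)
end

section
/- For any real numbers 0 < a < b there exists a constant C > 0, depending only on a, b and the polynomial P_0, such that for every 0 ≤ k ≤ d−1 and every s ∈ ℂ with a ≤ Re s ≤ b, one has |Ω_k(s)| ≤ C e^{−(2πk/d)·Im s}. -/
theorem exists_mul_pow_le_add_mul_pow {k d : ℕ} (hkd : k < d) {c ε : ℝ} (hc : 0 ≤ c)
    (hε : 0 < ε) : ∃ K : ℝ, ∀ u : ℝ, 0 ≤ u → c * u ^ k ≤ K + ε * u ^ d := by
  refine ⟨c * max 1 (c / ε) ^ k, fun u hu => ?_⟩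
  rcases le_total u (max 1 (c / ε)) with h | h
  · have h1 : c * u ^ k ≤ c * max 1 (c / ε) ^ k := by gcongr
    have h2 : 0 ≤ ε * u ^ d := by positivity
    linarith
  · have h1 : 1 ≤ u := le_trans (le_max_left _ _) h
    have h2 : c ≤ u * ε := (div_le_iff₀ hε).1 (le_trans (le_max_right _ _) h)
    have h3 : u ^ (k + 1) ≤ u ^ d := pow_le_pow_right₀ h1 hkd
    have h4 : 0 ≤ c * max 1 (c / ε) ^ k := by positivity
    calc c * u ^ k ≤ u * ε * u ^ k := by gcongr
      _ = ε * u ^ (k + 1) := by ring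
      _ ≤ ε * u ^ d := by gcongr
      _ ≤ _ := by linarith

theorem norm_exp_two_pi_I_mul_div (k d : ℕ) :
    ‖Complex.exp (2 * Real.pi * Complex.I * k / d)‖ = 1 := by
  have : (2 * Real.pi * Complex.I * k / d : ℂ) = ((2 * Real.pi * k / d : ℝ) : ℂ) * Complex.I := by
    push_cast; ring
  rw [this, Complex.norm_exp_ofReal_mul_I]

theorem exp_two_pi_I_mul_div_pow {d : ℕ} (hd : 1 ≤ d) (k : ℕ) :
    Complex.exp (2 * Real.pi * Complex.I * k / d) ^ d = 1 := by
  have hd0 : (d : ℂ) ≠ 0 := Nat.cast_ne_zero.2 (by omega)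
  rw [← Complex.exp_nat_mul, mul_div_cancel₀ _ hd0, mul_comm, Complex.exp_nat_mul_two_pi_mul_I]

/-- On every ray in the direction of a `d`-th root of unity, `Re P₀` is at most
`K - u^d / (2d)` at distance `u` from the origin. -/
theorem exists_re_P0_le {d : ℕ} (hd : 1 ≤ d) (a : ℕ → ℂ) :
    ∃ K : ℝ, ∀ w : ℂ, ‖w‖ = 1 → w ^ d = 1 → ∀ u : ℝ, 0 ≤ u →
      (P0 d a (w * u)).re ≤ K - 1 / (2 * d) * u ^ d := by
  have hd0 : (0 : ℝ) < d := Nat.cast_pos.2 hd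
  have hε : (0 : ℝ) < 1 / (2 * d * d) := by positivity
  have hex : ∀ k : ℕ, ∃ K : ℝ, k < d → ∀ u : ℝ, 0 ≤ u →
      ‖a k‖ * u ^ k ≤ K + 1 / (2 * d * d) * u ^ d := fun k => by
    by_cases hk : k < d
    · obtain ⟨K, hK⟩ := exists_mul_pow_le_add_mul_pow hk (norm_nonneg (a k)) hε
      exact ⟨K, fun _ => hK⟩
    · exact ⟨0, fun h => absurd h hk⟩
  choose K hK using hex
  refine ⟨∑ k ∈ Finset.Ico 1 d, K k, fun w hw hwd u hu => ?_⟩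
  have hlead : (-(w * (u : ℂ)) ^ d / (d : ℂ)).re = -(u ^ d / d) := by
    rw [mul_pow, hwd, one_mul, neg_div, Complex.neg_re]
    norm_cast
  have hsum : (∑ k ∈ Finset.Ico 1 d, a k * (w * (u : ℂ)) ^ k).re ≤
      ∑ k ∈ Finset.Ico 1 d, K k + (d - 1 : ℕ) * (1 / (2 * d * d) * u ^ d) := by
    calc _ ≤ ‖∑ k ∈ Finset.Ico 1 d, a k * (w * (u : ℂ)) ^ k‖ := Complex.re_le_norm _
      _ ≤ ∑ k ∈ Finset.Ico 1 d, ‖a k‖ * u ^ k := by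
        refine norm_sum_le_of_le _ fun k _ => ?_
        simp [hw, abs_of_nonneg hu]
      _ ≤ ∑ k ∈ Finset.Ico 1 d, (K k + 1 / (2 * d * d) * u ^ d) :=
        Finset.sum_le_sum fun k hk => hK k (Finset.mem_Ico.1 hk).2 u hu
      _ = _ := by simp [Finset.sum_add_distrib]
  have hcast : ((d - 1 : ℕ) : ℝ) ≤ d := by exact_mod_cast Nat.sub_le d 1
  have hle : ((d - 1 : ℕ) : ℝ) * (1 / (2 * d * d) * u ^ d) ≤ d * (1 / (2 * d * d) * u ^ d) := by
    gcongr
  have heq : (d : ℝ) * (1 / (2 * d * d) * u ^ d) - u ^ d / d = -(1 / (2 * d) * u ^ d) := by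
    field_simp; ring
  rw [P0, Complex.add_re, hlead]
  linarith

theorem rpow_le_rpow_add_rpow {u x y z : ℝ} (hu : 0 < u) (hxy : x ≤ y) (hyz : y ≤ z) :
    u ^ y ≤ u ^ x + u ^ z := by
  have hx := Real.rpow_nonneg hu.le x
  have hz := Real.rpow_nonneg hu.le z
  rcases le_total u 1 with h | h
  · linarith [Real.rpow_le_rpow_of_exponent_ge hu h hxy]
  · linarith [Real.rpow_le_rpow_of_exponent_le h hyz]

theorem integrableOn_rpow_mul_exp_sub_mul_pow {d : ℕ} (hd : 1 ≤ d) {x b : ℝ} (hx : -1 < x)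
    (hb : 0 < b) (K : ℝ) :
    MeasureTheory.IntegrableOn (fun u : ℝ => u ^ x * Real.exp (K - b * u ^ d)) (Set.Ioi 0) := by
  have h := (integrableOn_rpow_mul_exp_neg_mul_rpow hx
    (p := (d : ℝ)) (by exact_mod_cast hd) hb).const_mul (Real.exp K)
  refine h.congr (Filter.Eventually.of_forall fun u => ?_)
  simp only [Real.rpow_natCast]
  rw [sub_eq_add_neg, Real.exp_add, neg_mul]
  ring

/-- For any `0 < A < B` there is `C > 0`, depending only on `A`, `B` and `P₀`,
such that for every `0 ≤ k ≤ d-1` and every `s` with `A ≤ Re s ≤ B`,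
`|Ω_k(s)| ≤ C e^{-(2πk/d)·Im s}`. -/
theorem stmt16 (d : ℕ) (hd : 1 ≤ d) (a : ℕ → ℂ)
    (A B : ℝ) (hA : 0 < A) (hAB : A < B) :
    ∃ C : ℝ, 0 < C ∧
      ∀ k, k ≤ d - 1 → ∀ s : ℂ, A ≤ s.re → s.re ≤ B →
        ‖OmegaFn d a k s‖ ≤ C * Real.exp (-(2 * Real.pi * k / d) * s.im) := by
  obtain ⟨K, hK⟩ := exists_re_P0_le hd a
  have hb : (0 : ℝ) < 1 / (2 * d) := by
    have : (0 : ℝ) < d := Nat.cast_pos.2 hd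
    positivity
  set g : ℝ → ℝ := fun u => u ^ (A - 1) * Real.exp (K - 1 / (2 * d) * u ^ d) +
    u ^ (B - 1) * Real.exp (K - 1 / (2 * d) * u ^ d) with hg
  have hgi : MeasureTheory.IntegrableOn g (Set.Ioi 0) :=
    (integrableOn_rpow_mul_exp_sub_mul_pow hd (by linarith) hb K).add
      (integrableOn_rpow_mul_exp_sub_mul_pow hd (by linarith) hb K)
  have hg0 : 0 ≤ ∫ u in Set.Ioi (0 : ℝ), g u :=
    MeasureTheory.setIntegral_nonneg measurableSet_Ioi fun u hu => by
      have : (0 : ℝ) < u := hu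
      positivity
  refine ⟨(∫ u in Set.Ioi (0 : ℝ), g u) + 1, by linarith, fun k _ s hAs hsB => ?_⟩
  have hexp : ‖Complex.exp (2 * Real.pi * Complex.I * k * s / d)‖ =
      Real.exp (-(2 * Real.pi * k / d) * s.im) := by
    have h : (2 * Real.pi * Complex.I * k * s / d : ℂ) =
        ((2 * Real.pi * k / d : ℝ) : ℂ) * (Complex.I * s) := by
      push_cast; ring
    rw [Complex.norm_exp, h, Complex.re_ofReal_mul, Complex.I_mul_re]
    ring_nf
  rw [OmegaFn, norm_mul, hexp, mul_comm]
  refine mul_le_mul_of_nonneg_right ?_ (Real.exp_pos _).le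
  refine le_trans (MeasureTheory.norm_integral_le_of_norm_le hgi ?_) (le_add_of_nonneg_right
    zero_le_one)
  refine (MeasureTheory.ae_restrict_iff' measurableSet_Ioi).2 (Filter.Eventually.of_forall ?_)
  intro u hu
  have hu : 0 < u := hu
  rw [norm_mul, Complex.norm_cpow_eq_rpow_re_of_pos hu, Complex.norm_exp, hg]
  simp only [← add_mul, Complex.sub_re, Complex.one_re]
  have h1 := rpow_le_rpow_add_rpow (x := A - 1) (y := s.re - 1) (z := B - 1) hu
    (by linarith) (by linarith)
  have h2 := hK _ (norm_exp_two_pi_I_mul_div k d) (exp_two_pi_I_mul_div_pow hd k) u hu.le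
  gcongr
end
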